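/- Let R be a commutative ring, let n and d be natural numbers with d ≤ n, and let x : Fin n → R. Then the sum over all d-element subsets S of Fin n of the products ∏_{i ∈ S} (1 - x i) equals ∑_{ℓ=0}^{d} (-1)^ℓ · (n-ℓ choose d-ℓ) · e_ℓ(x), where e_ℓ(x) = ∑_{L ⊆ Fin n, |L| = ℓ} ∏_{i ∈ L} x i is the ℓ-th elementary symmetric function of the x i, and the integer coefficients act via the canonical map ℤ → R. -/

import Mathlib

/-- The computational identity underlying the lift of the `d`-th Stiefel–Whitney class to a
Witt invariant: in any commutative ring `R`, for `d ≤ n` and elements `x i`,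
the sum over all `d`-element subsets `S` of `Fin n` of `∏_{i ∈ S} (1 - x i)` equals
`∑_{ℓ=0}^{d} (-1)^ℓ * (n-ℓ choose d-ℓ) * e_ℓ(x)`, where `e_ℓ` is the elementary symmetric
function. -/
theorem stmt0 (R : Type*) [CommRing R] (n d : ℕ) (hd : d ≤ n) (x : Fin n → R) :
    ∑ S ∈ Finset.powersetCard d (Finset.univ : Finset (Fin n)), ∏ i ∈ S, (1 - x i) =
      ∑ ℓ ∈ Finset.range (d + 1),
        ((((-1 : ℤ) ^ ℓ * ((n - ℓ).choose (d - ℓ) : ℤ)) : ℤ) : R) *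
          ∑ L ∈ Finset.powersetCard ℓ (Finset.univ : Finset (Fin n)), ∏ i ∈ L, x i := by
  classical
  have key : ∀ S ∈ Finset.powersetCard d (Finset.univ : Finset (Fin n)),
      ∏ i ∈ S, (1 - x i) = ∑ ℓ ∈ Finset.range (d + 1),
        ∑ L ∈ Finset.powersetCard ℓ (Finset.univ : Finset (Fin n)),
          if L ⊆ S then (-1 : R) ^ ℓ * ∏ i ∈ L, x i else 0 := by
    intro S hS
    have hc : S.card = d := (Finset.mem_powersetCard.mp hS).2
    have h1 : ∏ i ∈ S, (1 - x i) = ∏ i ∈ S, (-x i + 1) :=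
      Finset.prod_congr rfl fun i _ => by ring
    rw [h1, Finset.prod_add, Finset.sum_powerset, hc]
    refine Finset.sum_congr rfl fun ℓ _ => ?_
    rw [← Finset.sum_filter]
    refine Finset.sum_congr ?_ fun L hL => ?_
    · ext L
      simp [Finset.mem_powersetCard, and_comm]
    · have hl : L.card = ℓ := by
        have := (Finset.mem_filter.mp hL).1
        exact (Finset.mem_powersetCard.mp this).2
      simp [Finset.prod_neg, hl]
  rw [Finset.sum_congr rfl key, Finset.sum_comm]
  refine Finset.sum_congr rfl fun ℓ hℓ => ?_
  rw [Finset.sum_comm, Finset.mul_sum]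
  refine Finset.sum_congr rfl fun L hL => ?_
  have hl : L.card = ℓ := (Finset.mem_powersetCard.mp hL).2
  have hle : ℓ ≤ d := Nat.lt_succ_iff.mp (Finset.mem_range.mp hℓ)
  rw [← Finset.sum_filter, Finset.sum_const,
    Finset.card_filter_powersetCard_subset L Finset.univ d (Finset.subset_univ _) (hl ▸ hle),
    hl, Finset.card_univ, Fintype.card_fin, nsmul_eq_mul]
  push_cast
  ring
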